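/- Let α := α(I_X) be the least degree of a nonzero homogeneous element of I_X. Then dim_k (I_X)_α ≤ α + 1; equivalently, I_X has at most α+1 minimal generators of degree α. -/

import Mathlib

open MvPolynomial

/-- The homogeneous ideal of the point of `ℙ²` represented by `v ∈ k³`:
the ideal generated by all linear forms vanishing at `v`. -/
noncomputable def pointIdeal {k : Type*} [Field k] (v : Fin 3 → k) :
    Ideal (MvPolynomial (Fin 3) k) :=
  Ideal.span {f | f.IsHomogeneous 1 ∧ MvPolynomial.eval v f = 0}

/-- The ideal `I_X = ⋂ᵢ I_{vᵢ}` of the set of points represented by `v`. -/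
noncomputable def pointsIdeal {k : Type*} [Field k] {s : ℕ} (v : Fin s → (Fin 3 → k)) :
    Ideal (MvPolynomial (Fin 3) k) :=
  ⨅ i, pointIdeal (v i)

/-- The `m`-th symbolic power `I_X^{(m)} = ⋂ᵢ I_{vᵢ}^m`. -/
noncomputable def pointsSymb {k : Type*} [Field k] {s : ℕ} (v : Fin s → (Fin 3 → k)) (m : ℕ) :
    Ideal (MvPolynomial (Fin 3) k) :=
  ⨅ i, (pointIdeal (v i)) ^ m

/-- The degree-`t` graded component of an ideal of `k[x₀,x₁,x₂]`, as a `k`-subspace. -/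
noncomputable def gradedPiece {k : Type*} [Field k]
    (I : Ideal (MvPolynomial (Fin 3) k)) (t : ℕ) :
    Submodule k (MvPolynomial (Fin 3) k) :=
  Submodule.restrictScalars k I ⊓ MvPolynomial.homogeneousSubmodule (Fin 3) k t

/-- Evaluating a form of degree `t` at a multiple of a point scales the value by a `t`-th power. -/
lemma aeval_mul_algebraMap_of_isHomogeneous {k A σ : Type*} [CommSemiring k]
    [CommSemiring A] [Algebra k A] [Fintype σ] {f : MvPolynomial σ k} {t : ℕ}
    (hf : f.IsHomogeneous t) (z : A) (v : σ → k) :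
    aeval (fun i ↦ z * algebraMap k A (v i)) f = z ^ t * algebraMap k A (eval v f) := by
  rw [aeval_def, eval₂_eq', eval_eq', map_sum, Finset.mul_sum]
  refine Finset.sum_congr rfl fun d hd ↦ ?_
  have hdeg : ∑ i, d i = t := by
    rw [← Finsupp.degree_eq_sum, Finsupp.degree_eq_weight_one]
    exact hf (mem_support_iff.mp hd)
  simp only [mul_pow, Finset.prod_mul_distrib, map_mul, map_prod, map_pow,
    Finset.prod_pow_eq_pow_sum, hdeg]
  ring

lemma eval_eq_zero_of_mem_pointIdeal {k : Type*} [Field k] {v : Fin 3 → k}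
    {f : MvPolynomial (Fin 3) k} (hf : f ∈ pointIdeal v) : eval v f = 0 := by
  have h : pointIdeal v ≤ RingHom.ker (eval v) := Ideal.span_le.mpr fun g hg ↦ hg.2
  exact h hf

lemma mem_pointIdeal_of_eval_eq_zero {k : Type*} [Field k] {v : Fin 3 → k} (hv : v ≠ 0)
    {f : MvPolynomial (Fin 3) k} {t : ℕ} (hf : f.IsHomogeneous t) (h0 : eval v f = 0) :
    f ∈ pointIdeal v := by
  obtain ⟨j, hj⟩ := Function.ne_iff.mp hv
  rw [Pi.zero_apply] at hj
  let q := Ideal.Quotient.mkₐ k (pointIdeal v)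
  have hX (i : Fin 3) :
      q (X i) = q (C (v j)⁻¹ * X j) * algebraMap k _ (v i) := by
    have hmem : X i - C (v j)⁻¹ * X j * C (v i) ∈ pointIdeal v := by
      refine Ideal.subset_span ⟨?_, ?_⟩
      · refine (isHomogeneous_X k i).sub ?_
        simpa using (((isHomogeneous_C (Fin 3) (v j)⁻¹).mul (isHomogeneous_X k j)).mul
          (isHomogeneous_C (Fin 3) (v i)))
      · simp [hj]
    have h := (Ideal.Quotient.mk_eq_mk_iff_sub_mem _ _).mpr hmem
    rw [map_mul] at h
    exact h
  have hq : q f = 0 := by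
    have h := aeval_mul_algebraMap_of_isHomogeneous hf (q (C (v j)⁻¹ * X j)) v
    simp_rw [← hX] at h
    rw [h0, map_zero, mul_zero, ← comp_aeval_apply, aeval_X_left_apply] at h
    exact h
  exact Ideal.Quotient.eq_zero_iff_mem.mp hq

instance finiteDimensional_homogeneousSubmodule {k : Type*} [Field k] (t : ℕ) :
    FiniteDimensional k (homogeneousSubmodule (Fin 3) k t) :=
  Module.Finite.iff_fg.mpr (homogeneousSubmodule_fg _ _ _)

lemma finrank_homogeneousSubmodule (σ k : Type*) [Fintype σ] [DecidableEq σ] [Field k] (t : ℕ) :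
    Module.finrank k (homogeneousSubmodule σ k t) = (Fintype.card σ).multichoose t := by
  have hset : {d : σ →₀ ℕ | d.degree = t} =
      ((Finset.univ : Finset σ).finsuppAntidiag t : Finset (σ →₀ ℕ)) := by
    ext d
    simp [Finsupp.degree_eq_sum]
  rw [homogeneousSubmodule_eq_finsupp_supported, hset,
    (AddMonoidAlgebra.supportedEquivFinsupp (R := k) (S := k) _).finrank_eq,
    Module.finrank_finsupp_self]
  simp [Finset.card_finsuppAntidiag_nat_eq_multichoose]

/-- Evaluation at a point, as a functional on forms of degree `t`. -/
noncomputable def evalForm {k : Type*} [Field k] (t : ℕ) (v : Fin 3 → k) :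
    Module.Dual k (homogeneousSubmodule (Fin 3) k t) :=
  (aeval v).toLinearMap ∘ₗ (homogeneousSubmodule (Fin 3) k t).subtype

lemma evalForm_apply {k : Type*} [Field k] {t : ℕ} (v : Fin 3 → k)
    (f : homogeneousSubmodule (Fin 3) k t) : evalForm t v f = eval v (f : MvPolynomial _ k) := by
  simp [evalForm, aeval_eq_eval]

/-- Points imposing independent conditions on forms of degree `t` also do so in degree `t + 1`. -/
lemma linearIndependent_evalForm_succ {k κ : Type*} [Field k] [Fintype κ] {t : ℕ}
    {w : κ → Fin 3 → k} (hw : ∀ i, w i ≠ 0)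
    (hli : LinearIndependent k fun i ↦ evalForm t (w i)) :
    LinearIndependent k fun i ↦ evalForm (t + 1) (w i) := by
  rw [Fintype.linearIndependent_iff] at hli ⊢
  intro c hc i
  obtain ⟨j, hj⟩ := Function.ne_iff.mp (hw i)
  refine (mul_eq_zero.mp (hli (fun i ↦ c i * w i j) ?_ i)).resolve_right hj
  ext g
  have h := LinearMap.congr_fun hc ⟨(g : MvPolynomial (Fin 3) k) * X j, IsHomogeneous.mul g.2 (isHomogeneous_X k j)⟩
  simp only [LinearMap.sum_apply, LinearMap.smul_apply, evalForm_apply, smul_eq_mul, map_mul,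
    eval_X, LinearMap.zero_apply] at h ⊢
  rw [← h]
  exact Finset.sum_congr rfl fun i _ ↦ by ring

theorem points_gens_in_initial_degree (k : Type*) [Field k] (s : ℕ) (hs : 1 ≤ s)
    (v : Fin s → (Fin 3 → k)) (hv0 : ∀ i, v i ≠ 0)
    (hvind : ∀ i j, i ≠ j → LinearIndependent k ![v i, v j])
    (α : ℕ) (hα : α = sInf {t : ℕ | gradedPiece (pointsIdeal v) t ≠ ⊥}) :
    Module.finrank k (gradedPiece (pointsIdeal v) α) ≤ α + 1 := by
  rcases α with _ | t
  · refine (Submodule.finrank_mono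
      (inf_le_right : _ ≤ homogeneousSubmodule (Fin 3) k 0)).trans ?_
    simp [finrank_homogeneousSubmodule]
  have hbot : gradedPiece (pointsIdeal v) t = ⊥ := by
    by_contra h
    have := Nat.sInf_le (s := {t : ℕ | gradedPiece (pointsIdeal v) t ≠ ⊥}) h
    omega
  obtain ⟨κ, a, ha, hspan, hli⟩ := exists_linearIndependent' k fun i ↦ evalForm t (v i)
  have : Fintype κ := Fintype.ofInjective a ha
  have hV : Fintype.card κ = Module.finrank k (homogeneousSubmodule (Fin 3) k t) := by
    have hco : (Submodule.span k (Set.range fun i ↦ evalForm t (v i))).dualCoannihilator = ⊥ := by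
      refine (Submodule.eq_bot_iff _).mpr fun g hg ↦ ?_
      have hmem : (g : MvPolynomial (Fin 3) k) ∈ gradedPiece (pointsIdeal v) t := by
        refine ⟨(Submodule.mem_iInf _).mpr fun i ↦
          mem_pointIdeal_of_eval_eq_zero (hv0 i) g.2 ?_, g.2⟩
        rw [← evalForm_apply]
        exact (Submodule.mem_dualCoannihilator g).mp hg _ (Submodule.subset_span ⟨i, rfl⟩)
      rw [hbot, Submodule.mem_bot] at hmem
      exact Subtype.ext hmem
    rw [← Subspace.finrank_add_finrank_dualCoannihilator_eq
      (Submodule.span k (Set.range fun i ↦ evalForm t (v i))), hco, finrank_bot, add_zero,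
      ← hspan, finrank_span_eq_card hli]
  have hli' := linearIndependent_evalForm_succ (fun i ↦ hv0 (a i)) hli
  have hW := Subspace.finrank_add_finrank_dualCoannihilator_eq
    (Submodule.span k (Set.range fun i ↦ evalForm (t + 1) (v (a i))))
  rw [finrank_span_eq_card hli', hV, finrank_homogeneousSubmodule, finrank_homogeneousSubmodule,
    Fintype.card_fin, Nat.multichoose_succ_succ, Nat.multichoose_two, show 2 + 1 = 3 from rfl] at hW
  have hle : Module.finrank k (gradedPiece (pointsIdeal v) (t + 1)) ≤ Module.finrank k
      (Submodule.span k (Set.range fun i ↦ evalForm (t + 1) (v (a i)))).dualCoannihilator := by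
    have hsub : gradedPiece (pointsIdeal v) (t + 1) ≤ homogeneousSubmodule (Fin 3) k (t + 1) :=
      inf_le_right
    rw [← (Submodule.comapSubtypeEquivOfLe hsub).finrank_eq]
    refine Submodule.finrank_mono fun g hg ↦ ?_
    rw [← SetLike.mem_coe, Submodule.coe_dualCoannihilator_span]
    rintro _ ⟨i, rfl⟩
    rw [evalForm_apply]
    exact eval_eq_zero_of_mem_pointIdeal ((Submodule.mem_iInf _).mp hg.1 (a i))
  omega
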